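/- arXiv:1811.09188 — 6 statements merged into one kernel-verified Lean document; each statement's English description precedes it below -/
import Mathlib

section
/- Let M be a Metzler matrix partitioned in blocks as M = [[M₁₁, M₁₂],[M₂₁, M₂₂]] where M₁₁ ∈ ℝ^{p×p} and M₂₂ ∈ ℝ^{q×q} are square (so M₁₁, M₂₂ are Metzler and M₁₂, M₂₁ are entrywise nonnegative). Then M is Hurwitz stable if and only if M₂₂ is Hurwitz stable (hence invertible) and the Schur complement M₁₁ - M₁₂ M₂₂^{-1} M₂₁ is Hurwitz stable. -/
open Matrix

/-- A real square matrix is Metzler if all its off-diagonal entries are nonnegative. -/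
def IsMetzler {n : Type*} [Fintype n] (M : Matrix n n ℝ) : Prop :=
  ∀ i j, i ≠ j → 0 ≤ M i j

/-- A real square matrix is Hurwitz stable if every complex eigenvalue (i.e. every
complex root of its characteristic polynomial) has negative real part. -/
def IsHurwitz {n : Type*} [Fintype n] [DecidableEq n] (M : Matrix n n ℝ) : Prop :=
  ∀ z : ℂ, (M.map (Complex.ofReal)).charpoly.IsRoot z → z.re < 0

section helpers

variable {n : Type*} [Fintype n] [DecidableEq n]

lemma mz_row (M : Matrix n n ℝ) (hM : IsMetzler M) (y : n → ℝ) (hy : ∀ j, 0 ≤ y j)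
    (i : n) (hi : y i = 0) : 0 ≤ (M *ᵥ y) i := by
  simp only [mulVec, dotProduct]
  apply Finset.sum_nonneg
  intro j _
  by_cases h : i = j
  · subst h; simp [hi]
  · exact mul_nonneg (hM i j h) (hy j)

lemma mz_mono (M : Matrix n n ℝ) (hM : IsMetzler M) (v : n → ℝ) (hv : ∀ i, 0 < v i)
    (hMv : ∀ i, (M *ᵥ v) i < 0) (x : n → ℝ) (hx : ∀ i, (M *ᵥ x) i ≤ 0) (k : n) : 0 ≤ x k := by
  have : Nonempty n := ⟨k⟩
  obtain ⟨i, hi⟩ := Finite.exists_min (fun i => x i / v i)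
  by_contra! hk
  have hc : x i / v i < 0 := lt_of_le_of_lt (hi k) (div_neg_of_neg_of_pos hk (hv k))
  set c := x i / v i with hcdef
  have h1 := mz_row M hM (x - c • v) (fun j => by
    have := (le_div_iff₀ (hv j)).1 (hi j)
    simp only [Pi.sub_apply, Pi.smul_apply, smul_eq_mul]
    linarith) i (by
    have := (hv i).ne'
    simp only [Pi.sub_apply, Pi.smul_apply, smul_eq_mul, hcdef]
    field_simp
    simp)
  rw [mulVec_sub, mulVec_smul] at h1
  simp only [Pi.sub_apply, Pi.smul_apply, smul_eq_mul] at h1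
  have := mul_pos_of_neg_of_neg hc (hMv i)
  linarith [hx i]

lemma mz_hurwitz (M : Matrix n n ℝ) (hM : IsMetzler M) (v : n → ℝ) (hv : ∀ i, 0 < v i)
    (hMv : ∀ i, (M *ᵥ v) i < 0) : IsHurwitz M := by
  intro z hz
  rw [Polynomial.IsRoot, Matrix.eval_charpoly] at hz
  obtain ⟨x, hx0, hx⟩ := Matrix.exists_mulVec_eq_zero_iff.2 hz
  obtain ⟨k, hk⟩ := Function.ne_iff.1 hx0
  have : Nonempty n := ⟨k⟩
  obtain ⟨i, hi⟩ := Finite.exists_max (fun i => ‖x i‖ / v i)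
  set c := ‖x i‖ / v i with hcdef
  have hc : 0 < c := lt_of_lt_of_le (div_pos (norm_pos_iff.2 hk) (hv k)) (hi k)
  have hxi : ‖x i‖ = c * v i := by
    have := (hv i).ne'
    rw [hcdef]; field_simp
  have hxj : ∀ j, ‖x j‖ ≤ c * v j := fun j => (div_le_iff₀ (hv j)).1 (hi j)
  have h1 := congrFun hx i
  rw [sub_mulVec] at h1
  simp only [Pi.sub_apply, Pi.zero_apply, scalar_apply, mulVec_diagonal] at h1
  simp only [mulVec, dotProduct, map_apply] at h1
  rw [← Finset.add_sum_erase _ _ (Finset.mem_univ i)] at h1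
  have h2 : (z - (M i i : ℂ)) * x i = ∑ j ∈ Finset.univ.erase i, (M i j : ℂ) * x j := by
    linear_combination h1
  have h3 : ‖z - (M i i : ℂ)‖ * ‖x i‖ ≤ c * ∑ j ∈ Finset.univ.erase i, M i j * v j := by
    rw [← norm_mul, h2, Finset.mul_sum]
    refine (norm_sum_le _ _).trans (Finset.sum_le_sum fun j hj => ?_)
    have h0 := hM i j (Finset.ne_of_mem_erase hj).symm
    rw [norm_mul, Complex.norm_real, Real.norm_of_nonneg h0]
    nlinarith [mul_le_mul_of_nonneg_left (hxj j) h0]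
  have h4 := hMv i
  simp only [mulVec, dotProduct] at h4
  rw [← Finset.add_sum_erase _ _ (Finset.mem_univ i)] at h4
  have h5 : ‖z - (M i i : ℂ)‖ < - M i i := by
    rw [hxi] at h3
    have h6 : c * (‖z - (M i i : ℂ)‖ * v i) < c * (- M i i * v i) := by nlinarith
    exact lt_of_mul_lt_mul_right (lt_of_mul_lt_mul_left h6 hc.le) (hv i).le
  have h7 := Complex.re_le_norm (z - (M i i : ℂ))
  simp at h7
  linarith

lemma hurwitz_det (M : Matrix n n ℝ) (h : IsHurwitz M) (t : ℝ) (ht : 0 ≤ t) :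
    (scalar n t - M).det ≠ 0 := by
  intro h0
  have := h (t : ℂ) (by
    rw [Polynomial.IsRoot, Matrix.eval_charpoly]
    have h1 : scalar n (t : ℂ) - M.map Complex.ofReal
        = Complex.ofRealHom.mapMatrix (scalar n t - M) := by
      ext i j
      by_cases hij : i = j
      · subst hij; simp
      · simp [hij]
    rw [h1, ← RingHom.map_det, h0, map_zero])
  simp at this
  linarith

lemma hurwitz_vec (M : Matrix n n ℝ) (hM : IsMetzler M) (h : IsHurwitz M) :
    ∃ v : n → ℝ, (∀ i, 0 < v i) ∧ ∀ i, (M *ᵥ v) i < 0 := by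
  let A : ℝ → Matrix n n ℝ := fun t => scalar n t - M
  let w : ℝ → n → ℝ := fun t => (A t).det • ((A t).adjugate *ᵥ 1)
  have hA : Continuous A := by
    apply Continuous.sub _ continuous_const
    refine continuous_matrix fun i j => ?_
    simp only [scalar_apply, diagonal_apply]
    split_ifs <;> fun_prop
  have hw : Continuous w := by
    exact hA.matrix_det.smul (hA.matrix_adjugate.matrix_mulVec continuous_const)
  have hwi : ∀ i, Continuous fun t => w t i := fun i => (continuous_apply i).comp hw
  have hAw : ∀ t i, t * w t i - (M *ᵥ w t) i = (A t).det ^ 2 := by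
    intro t i
    have : A t *ᵥ w t = ((A t).det ^ 2) • 1 := by
      simp only [w]
      rw [mulVec_smul, mulVec_mulVec, mul_adjugate, smul_mulVec, one_mulVec, smul_smul, sq]
    have := congrFun this i
    simp only [A, sub_mulVec, Pi.sub_apply, scalar_apply, mulVec_diagonal] at this
    simpa [A] using this
  have hpos : ∀ t, 0 ≤ t → 0 < (A t).det ^ 2 := fun t ht => by
    have := hurwitz_det M h t ht
    positivity
  have key : ∀ t, 0 ≤ t → (∀ i, 0 ≤ w t i) → ∀ i, 0 < w t i := by
    intro t ht hn i
    refine lt_of_le_of_ne (hn i) fun h0 => ?_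
    have h1 := mz_row M hM (w t) hn i h0.symm
    have h2 := hAw t i
    rw [← h0] at h2
    linarith [hpos t ht]
  obtain ⟨T, hT0, hT⟩ : ∃ T : ℝ, 0 ≤ T ∧ ∀ i, 0 ≤ w T i := by
    let T : ℝ := ∑ i, |(M *ᵥ 1) i| + 1
    have hTT : ∀ i, (M *ᵥ 1) i < T := fun i => by
      have := Finset.single_le_sum (f := fun i => |(M *ᵥ 1) i|) (fun i _ => abs_nonneg _)
        (Finset.mem_univ i)
      have h2 := le_abs_self ((M *ᵥ 1) i)
      simp only [T]
      linarith
    have hT0 : 0 ≤ T := by simp only [T]; positivity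
    refine ⟨T, hT0, ?_⟩
    refine mz_mono (M - scalar n T) ?_ 1 (fun i => by simp) ?_ (w T) ?_
    · intro i j hij
      simpa [hij] using hM i j hij
    · intro i
      simp only [sub_mulVec, Pi.sub_apply, scalar_apply, mulVec_diagonal, Pi.one_apply]
      linarith [hTT i]
    · intro i
      simp only [sub_mulVec, Pi.sub_apply, scalar_apply, mulVec_diagonal]
      linarith [hAw T i, hpos T hT0]
  have hU : IsOpen {t : ℝ | ∀ i, 0 < w t i} := by
    simp only [Set.ofPred_forall]
    exact isOpen_iInter_of_finite fun i => isOpen_lt continuous_const (hwi i)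
  have hV : IsOpen {t : ℝ | ∃ i, w t i < 0} := by
    simp only [Set.ofPred_exists]
    exact isOpen_iUnion fun i => isOpen_lt (hwi i) continuous_const
  have hsub : Set.Ici (0:ℝ) ⊆ {t : ℝ | ∀ i, 0 < w t i} := by
    refine isPreconnected_Ici.subset_left_of_subset_union hU hV ?_ ?_ ⟨T, hT0, key T hT0 hT⟩
    · rw [Set.disjoint_left]
      rintro t h1 ⟨i, hi⟩
      exact absurd (h1 i) hi.not_gt
    · intro t ht
      by_cases hn : ∀ i, 0 ≤ w t i
      · exact Or.inl (key t ht hn)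
      · push Not at hn
        exact Or.inr hn
  refine ⟨w 0, hsub (Set.mem_Ici.2 le_rfl), fun i => ?_⟩
  have := hAw 0 i
  linarith [hpos 0 le_rfl]

lemma hurwitz_unit (M : Matrix n n ℝ) (h : IsHurwitz M) : IsUnit M.det := by
  have := hurwitz_det M h 0 le_rfl
  rw [map_zero, zero_sub, det_neg] at this
  exact isUnit_iff_ne_zero.2 (right_ne_zero_of_mul this)

/-- `-M⁻¹` preserves nonnegative vectors. -/
lemma mz_inv_nonpos (M : Matrix n n ℝ) (hM : IsMetzler M) (h : IsHurwitz M) (b : n → ℝ)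
    (hb : ∀ i, 0 ≤ b i) (i : n) : (M⁻¹ *ᵥ b) i ≤ 0 := by
  obtain ⟨v, hv, hMv⟩ := hurwitz_vec M hM h
  have := mz_mono M hM v hv hMv (-(M⁻¹ *ᵥ b)) (fun j => by
    rw [mulVec_neg, mulVec_mulVec, mul_nonsing_inv _ (hurwitz_unit M h), one_mulVec]
    simpa using hb j) i
  simpa using this

end helpers

/-- A block-partitioned Metzler matrix `M = [[M₁₁, M₁₂],[M₂₁, M₂₂]]` is Hurwitz
stable if and only if `M₂₂` is Hurwitz stable (hence invertible) and the Schur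
complement `M₁₁ - M₁₂ M₂₂⁻¹ M₂₁` is Hurwitz stable. -/
theorem metzler_block_hurwitz_iff_schur (p q : ℕ)
    (M11 : Matrix (Fin p) (Fin p) ℝ) (M12 : Matrix (Fin p) (Fin q) ℝ)
    (M21 : Matrix (Fin q) (Fin p) ℝ) (M22 : Matrix (Fin q) (Fin q) ℝ)
    (hM : IsMetzler (Matrix.fromBlocks M11 M12 M21 M22)) :
    IsHurwitz (Matrix.fromBlocks M11 M12 M21 M22) ↔
      IsHurwitz M22 ∧ IsHurwitz (M11 - M12 * M22⁻¹ * M21) := by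
  have h11 : IsMetzler M11 := fun i j hij => by
    simpa using hM (Sum.inl i) (Sum.inl j) (by simpa using hij)
  have h22 : IsMetzler M22 := fun i j hij => by
    simpa using hM (Sum.inr i) (Sum.inr j) (by simpa using hij)
  have h12 : ∀ i j, 0 ≤ M12 i j := fun i j => by
    simpa using hM (Sum.inl i) (Sum.inr j) (by simp)
  have h21 : ∀ i j, 0 ≤ M21 i j := fun i j => by
    simpa using hM (Sum.inr i) (Sum.inl j) (by simp)
  have n12 : ∀ y : Fin q → ℝ, (∀ j, 0 ≤ y j) → ∀ i, 0 ≤ (M12 *ᵥ y) i := fun y hy i =>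
    by
      simp only [mulVec, dotProduct]
      exact Finset.sum_nonneg fun j _ => mul_nonneg (h12 i j) (hy j)
  have n21 : ∀ y : Fin p → ℝ, (∀ j, 0 ≤ y j) → ∀ i, 0 ≤ (M21 *ᵥ y) i := fun y hy i =>
    by
      simp only [mulVec, dotProduct]
      exact Finset.sum_nonneg fun j _ => mul_nonneg (h21 i j) (hy j)
  have hSv : ∀ y, (M11 - M12 * M22⁻¹ * M21) *ᵥ y
      = M11 *ᵥ y + M12 *ᵥ (-(M22⁻¹ *ᵥ (M21 *ᵥ y))) := fun y => by
    rw [sub_mulVec, mulVec_neg, mulVec_mulVec, mulVec_mulVec, ← sub_eq_add_neg, Matrix.mul_assoc]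
  have hS : IsHurwitz M22 → IsMetzler (M11 - M12 * M22⁻¹ * M21) := by
    intro hH i j hij
    have e : (M11 - M12 * M22⁻¹ * M21) i j
        = ((M11 - M12 * M22⁻¹ * M21) *ᵥ Pi.single j 1) i := by simp
    rw [e, hSv]
    have a := n12 (-(M22⁻¹ *ᵥ (M21 *ᵥ Pi.single j 1))) (fun k => by
      have := mz_inv_nonpos M22 h22 hH (M21 *ᵥ Pi.single j 1)
        (n21 _ (fun l => by by_cases hl : l = j <;> simp [Pi.single_apply, hl])) k
      rw [Pi.neg_apply]; linarith) i
    have b := h11 i j hij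
    have c : (M11 *ᵥ Pi.single j 1) i = M11 i j := by simp
    rw [Pi.add_apply, c]
    linarith
  constructor
  · intro hH
    obtain ⟨v, hv, hMv⟩ := hurwitz_vec _ hM hH
    have e1 : ∀ i, (M11 *ᵥ (v ∘ Sum.inl)) i + (M12 *ᵥ (v ∘ Sum.inr)) i < 0 := fun i => by
      have := hMv (Sum.inl i)
      rw [fromBlocks_mulVec] at this
      simpa using this
    have e2 : ∀ i, (M21 *ᵥ (v ∘ Sum.inl)) i + (M22 *ᵥ (v ∘ Sum.inr)) i < 0 := fun i => by
      have := hMv (Sum.inr i)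
      rw [fromBlocks_mulVec] at this
      simpa using this
    generalize hv1 : v ∘ Sum.inl = v1 at e1 e2
    generalize hv2 : v ∘ Sum.inr = v2 at e1 e2
    have p1 : ∀ i, 0 < v1 i := fun i => by rw [← hv1]; exact hv _
    have p2 : ∀ i, 0 < v2 i := fun i => by rw [← hv2]; exact hv _
    have H22 : IsHurwitz M22 := mz_hurwitz M22 h22 v2 p2 fun i => by
      have := n21 v1 (fun j => (p1 j).le) i
      linarith [e2 i]
    refine ⟨H22, mz_hurwitz _ (hS H22) v1 p1 fun i => ?_⟩
    rw [hSv]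
    have a : ∀ k, 0 ≤ v2 k - (-(M22⁻¹ *ᵥ (M21 *ᵥ v1))) k := fun k => by
      have := mz_inv_nonpos M22 h22 H22 (-(M21 *ᵥ v1 + M22 *ᵥ v2)) (fun j => by
        simp only [Pi.neg_apply, Pi.add_apply]; linarith [e2 j]) k
      rw [mulVec_neg, mulVec_add, mulVec_mulVec v2, nonsing_inv_mul _ (hurwitz_unit M22 H22),
        one_mulVec] at this
      simp only [Pi.neg_apply, Pi.add_apply] at this ⊢
      linarith
    have b := n12 (v2 - (-(M22⁻¹ *ᵥ (M21 *ᵥ v1)))) a i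
    rw [mulVec_sub, Pi.sub_apply] at b
    rw [Pi.add_apply]
    linarith [e1 i]
  · rintro ⟨H22, HS⟩
    obtain ⟨v1, p1, hv1⟩ := hurwitz_vec _ (hS H22) HS
    obtain ⟨u, pu, hu⟩ := hurwitz_vec _ h22 H22
    obtain ⟨ε, hε, hε2⟩ : ∃ ε : ℝ, 0 < ε ∧
        ∀ i, ((M11 - M12 * M22⁻¹ * M21) *ᵥ v1) i + ε * (M12 *ᵥ u) i < 0 := by
      have : ∀ᶠ ε in nhdsWithin (0:ℝ) (Set.Ioi 0),
          ∀ i, ((M11 - M12 * M22⁻¹ * M21) *ᵥ v1) i + ε * (M12 *ᵥ u) i < 0 := by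
        rw [Filter.eventually_all]
        intro i
        apply Filter.Eventually.filter_mono nhdsWithin_le_nhds
        have hc : Continuous fun ε : ℝ =>
          ((M11 - M12 * M22⁻¹ * M21) *ᵥ v1) i + ε * (M12 *ᵥ u) i := by fun_prop
        exact (hc.tendsto 0).eventually_lt_const (by simpa using hv1 i)
      obtain ⟨ε, h1, h2⟩ := (this.and self_mem_nhdsWithin).exists
      exact ⟨ε, h2, h1⟩
    let v2 : Fin q → ℝ := -(M22⁻¹ *ᵥ (M21 *ᵥ v1)) + ε • u
    have p2 : ∀ i, 0 < v2 i := fun i => by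
      have := mz_inv_nonpos M22 h22 H22 _ (n21 v1 fun j => (p1 j).le) i
      have := mul_pos hε (pu i)
      simp only [v2, Pi.add_apply, Pi.neg_apply, Pi.smul_apply, smul_eq_mul]
      linarith
    refine mz_hurwitz _ hM (Sum.elim v1 v2) ?_ ?_
    · rintro (i | i)
      · exact p1 i
      · exact p2 i
    · rw [fromBlocks_mulVec]
      simp only [Sum.elim_comp_inl, Sum.elim_comp_inr]
      rintro (i | i)
      · have := hε2 i
        rw [hSv] at this
        simp only [Sum.elim_inl, v2]
        rw [mulVec_add, mulVec_smul]
        simp only [Pi.add_apply, Pi.smul_apply, smul_eq_mul] at this ⊢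
        linarith
      · simp only [Sum.elim_inr, v2]
        rw [mulVec_add, mulVec_smul, mulVec_neg, mulVec_mulVec (M21 *ᵥ v1),
          mul_nonsing_inv _ (hurwitz_unit M22 H22), one_mulVec]
        simp only [Pi.add_apply, Pi.neg_apply, Pi.smul_apply, smul_eq_mul]
        have := mul_neg_of_pos_of_neg hε (hu i)
        linarith
end

section
/- Let M be a d×d Metzler matrix. Then M is Hurwitz stable if and only if there exists a vector v ∈ ℝ^d with all entries positive such that vᵀM has all entries negative (equivalently, V(x) = vᵀx is a linear copositive Lyapunov function for the linear dynamics ẋ = Mx). -/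
open Matrix

theorem metz_backward (d : ℕ) (M : Matrix (Fin d) (Fin d) ℝ) (hM : IsMetzler M)
    (v : Fin d → ℝ) (hv : ∀ i, 0 < v i) (hvM : ∀ j, (v ᵥ* M) j < 0) : IsHurwitz M := by
  intro z hz
  have hdet : (Matrix.scalar (Fin d) z - M.map Complex.ofReal).det = 0 := by
    rw [← Matrix.eval_charpoly]; exact hz
  obtain ⟨x, hx0, hx⟩ := Matrix.exists_mulVec_eq_zero_iff.mpr hdet
  have key : ∀ i, z.re * ‖x i‖ ≤ (M *ᵥ fun j => ‖x j‖) i := by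
    intro i
    have h1 : z * x i = ∑ j, (M i j : ℂ) * x j := by
      have := congrFun hx i
      rw [Matrix.sub_mulVec] at this
      simp only [Matrix.scalar_apply, Pi.sub_apply, Matrix.mulVec_diagonal, Pi.zero_apply] at this
      rw [sub_eq_zero] at this
      simpa [Matrix.mulVec, dotProduct] using this
    rw [← Finset.add_sum_erase _ _ (Finset.mem_univ i)] at h1
    have h2 : (z - (M i i : ℂ)) * x i = ∑ j ∈ Finset.univ.erase i, (M i j : ℂ) * x j := by
      rw [sub_mul, h1]; ring
    have h3 : ‖z - (M i i : ℂ)‖ * ‖x i‖ ≤ ∑ j ∈ Finset.univ.erase i, M i j * ‖x j‖ := by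
      rw [← norm_mul, h2]
      refine (norm_sum_le _ _).trans (Finset.sum_le_sum fun j hj => ?_)
      rw [norm_mul, Complex.norm_real, Real.norm_of_nonneg]
      exact hM i j (Finset.ne_of_mem_erase hj).symm
    have h4 : z.re - M i i ≤ ‖z - (M i i : ℂ)‖ := by
      have := Complex.re_le_norm (z - (M i i : ℂ))
      simpa using this
    have h5 := mul_le_mul_of_nonneg_right h4 (norm_nonneg (x i))
    have h6 : (M *ᵥ fun j => ‖x j‖) i
        = M i i * ‖x i‖ + ∑ j ∈ Finset.univ.erase i, M i j * ‖x j‖ := by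
      rw [Finset.add_sum_erase _ (fun j => M i j * ‖x j‖) (Finset.mem_univ i)]; rfl
    rw [h6]; nlinarith
  obtain ⟨k, hk⟩ := Function.ne_iff.mp hx0
  have hk' : 0 < ‖x k‖ := norm_pos_iff.mpr hk
  have hneg : ∑ j, (v ᵥ* M) j * ‖x j‖ < 0 := by
    apply Finset.sum_neg' (fun j _ => mul_nonpos_of_nonpos_of_nonneg (hvM j).le (norm_nonneg _))
    exact ⟨k, Finset.mem_univ k, mul_neg_of_neg_of_pos (hvM k) hk'⟩
  have heq : ∑ j, (v ᵥ* M) j * ‖x j‖ = ∑ i, v i * (M *ᵥ fun j => ‖x j‖) i :=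
    (Matrix.dotProduct_mulVec v M fun j => ‖x j‖).symm
  have hle : ∑ i, v i * (z.re * ‖x i‖) ≤ ∑ i, v i * (M *ᵥ fun j => ‖x j‖) i :=
    Finset.sum_le_sum fun i _ => mul_le_mul_of_nonneg_left (key i) (hv i).le
  by_contra hcon
  push Not at hcon
  have : 0 ≤ ∑ i, v i * (z.re * ‖x i‖) :=
    Finset.sum_nonneg fun i _ => mul_nonneg (hv i).le (mul_nonneg hcon (norm_nonneg _))
  linarith

theorem metz_forward (d : ℕ) (M : Matrix (Fin d) (Fin d) ℝ) (hM : IsMetzler M)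
    (hH : IsHurwitz M) : ∃ v : Fin d → ℝ, (∀ i, 0 < v i) ∧ ∀ j, (v ᵥ* M) j < 0 := by
  let A : ℝ → Matrix (Fin d) (Fin d) ℝ := fun t => Matrix.scalar (Fin d) t - M
  have hdet : ∀ t : ℝ, 0 ≤ t → (A t).det ≠ 0 := by
    intro t ht h0
    have : ((t : ℂ)).re < 0 := by
      apply hH
      have hc : (M.map Complex.ofReal).charpoly = M.charpoly.map Complex.ofRealHom :=
        Matrix.charpoly_map M Complex.ofRealHom
      rw [hc, Polynomial.IsRoot.def]
      have : (t : ℂ) = Complex.ofRealHom t := rfl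
      rw [this, Polynomial.eval_map_apply, Matrix.eval_charpoly]
      change Complex.ofRealHom (A t).det = 0
      rw [h0, map_zero]
    simp at this
    linarith
  have hA : Continuous A := by
    refine Continuous.sub ?_ continuous_const
    exact Continuous.matrix_diagonal (continuous_pi fun _ => continuous_id)
  let f : Set.Ici (0 : ℝ) → Fin d → ℝ :=
    fun t => ((A t).det)⁻¹ • ((fun _ => (1 : ℝ)) ᵥ* (A t).adjugate)
  have hA' : Continuous fun t : Set.Ici (0 : ℝ) => A t := hA.comp continuous_subtype_val
  have hf : Continuous f := by
    refine Continuous.smul (Continuous.inv₀ hA'.matrix_det fun t => hdet t t.2) ?_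
    exact Continuous.matrix_vecMul continuous_const hA'.matrix_adjugate
  have hfA : ∀ t : Set.Ici (0 : ℝ), f t ᵥ* A t = fun _ => 1 := by
    intro t
    simp only [f]
    rw [Matrix.smul_vecMul, Matrix.vecMul_vecMul, Matrix.adjugate_mul, Matrix.vecMul_smul,
      Matrix.vecMul_one, smul_smul, inv_mul_cancel₀ (hdet t t.2), one_smul]
  have hrow : ∀ (t : Set.Ici (0 : ℝ)) j, f t j * t = 1 + ∑ i, f t i * M i j := by
    intro t j
    have := congrFun (hfA t) j
    simp only [A] at this
    rw [Matrix.vecMul_sub] at this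
    simp only [Matrix.scalar_apply, Pi.sub_apply, Matrix.vecMul_diagonal] at this
    have h2 : (f t ᵥ* M) j = ∑ i, f t i * M i j := rfl
    linarith
  have hset : {t | ∀ i, 0 < f t i} = {t | ∀ i, 0 ≤ f t i} := by
    ext t
    refine ⟨fun h i => (h i).le, fun h j => lt_of_le_of_ne (h j) fun h0 => ?_⟩
    have h1 := hrow t j
    have h2 : 0 ≤ ∑ i, f t i * M i j := by
      refine Finset.sum_nonneg fun i _ => ?_
      by_cases hij : i = j
      · subst hij; rw [← h0]; simp
      · exact mul_nonneg (h i) (hM i j hij)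
    rw [← h0] at h1
    linarith
  have hopen : IsOpen {t | ∀ i, 0 < f t i} := by
    rw [Set.ofPred_forall]
    exact isOpen_iInter_of_finite fun i =>
      isOpen_lt continuous_const ((continuous_apply i).comp hf)
  have hclosed : IsClosed {t | ∀ i, 0 ≤ f t i} := by
    rw [Set.ofPred_forall]
    exact isClosed_iInter fun i =>
      isClosed_le continuous_const ((continuous_apply i).comp hf)
  have hne : {t | ∀ i, 0 < f t i}.Nonempty := by
    let T : ℝ := 1 + ∑ j, |∑ i, M i j|
    have hT : 0 ≤ T := by positivity
    refine ⟨⟨T, hT⟩, fun k => ?_⟩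
    set t : Set.Ici (0 : ℝ) := ⟨T, hT⟩ with ht
    obtain ⟨j, -, hj⟩ := Finset.exists_min_image Finset.univ (f t) ⟨k, Finset.mem_univ k⟩
    have hjT : ∑ i, M i j < T := by
      have h1 := le_abs_self (∑ i, M i j)
      have h2 := Finset.single_le_sum (f := fun j => |∑ i, M i j|)
        (fun j _ => abs_nonneg _) (Finset.mem_univ j)
      have h3 : |∑ i, M i j| ≤ ∑ j, |∑ i, M i j| := h2
      have h4 : T = 1 + ∑ j, |∑ i, M i j| := rfl
      linarith
    have h1 : f t j * T = 1 + ∑ i, f t i * M i j := hrow t j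
    have h2 : ∑ i, f t j * M i j ≤ ∑ i, f t i * M i j := by
      refine Finset.sum_le_sum fun i _ => ?_
      by_cases hij : i = j
      · subst hij; exact le_rfl
      · exact mul_le_mul_of_nonneg_right (hj i (Finset.mem_univ i)) (hM i j hij)
    rw [← Finset.mul_sum] at h2
    have h3 : 0 < f t j := by
      by_contra hc
      push Not at hc
      nlinarith
    exact h3.trans_le (hj k (Finset.mem_univ k))
  have : PreconnectedSpace (Set.Ici (0 : ℝ)) :=
    isPreconnected_iff_preconnectedSpace.mp isPreconnected_Ici
  have huniv : {t | ∀ i, 0 < f t i} = Set.univ :=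
    IsClopen.eq_univ ⟨hset ▸ hclosed, hopen⟩ hne
  let z : Set.Ici (0 : ℝ) := ⟨0, le_refl (0 : ℝ)⟩
  have hz : z ∈ {t | ∀ i, 0 < f t i} := huniv ▸ Set.mem_univ z
  refine ⟨f z, hz, fun j => ?_⟩
  have h1 : f z j * 0 = 1 + ∑ i, f z i * M i j := hrow z j
  have h2 : (f z ᵥ* M) j = ∑ i, f z i * M i j := rfl
  linarith

/-- A Metzler matrix `M` is Hurwitz stable if and only if there exists an entrywise
positive vector `v` such that `vᵀM` is entrywise negative (i.e. `V(x) = vᵀx` is a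
linear copositive Lyapunov function for `ẋ = Mx`). -/
theorem metzler_hurwitz_iff_linear_lyapunov (d : ℕ) (M : Matrix (Fin d) (Fin d) ℝ)
    (hM : IsMetzler M) :
    IsHurwitz M ↔ ∃ v : Fin d → ℝ, (∀ i, 0 < v i) ∧ ∀ j, (v ᵥ* M) j < 0 := by
  exact ⟨metz_forward d M hM, fun ⟨v, h1, h2⟩ => metz_backward d M hM v h1 h2⟩
end

section
/- Let n, d be positive integers, and for i = 1,…,n let H_i ∈ ℝ^{d_i×d_i} be Metzler, Hurwitz stable matrices with H_i𝟙 ≤ 0 entrywise, α_i ∈ ℝ^{1×d_i} be entrywise-nonnegative row vectors with α_i𝟙 = 1, and q_i ∈ ℝ^d be entrywise-nonnegative column vectors. Let A ∈ ℝ^{d×d} be Metzler and S ∈ ℝ^{d×n} be entrywise nonnegative. Set D = d₁+…+d_n, H = blockdiag(H₁,…,H_n), W_out = blockdiag(-𝟙ᵀH₁ᵀ,…,-𝟙ᵀH_nᵀ) ∈ ℝ^{n×D}, W_in ∈ ℝ^{n×d} the matrix with i-th row q_iᵀ, C ∈ ℝ^{D×d} the block-column matrix with i-th block α_iᵀ q_iᵀ,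 and B = S·W_out ∈ ℝ^{d×D}. Then the (d+D)×(d+D) block matrix 𝒜 = [[A, B],[C, Hᵀ]] is Hurwitz stable if and only if the d×d matrix A_df = A + S·W_in is Hurwitz stable. -/
open Matrix

/-- Minimum principle for Metzler matrices. -/
lemma metzler_pos_of_super {ι : Type*} [Fintype ι] {M : Matrix ι ι ℝ} (hM : IsMetzler M)
    {u z : ι → ℝ} (hu : ∀ i, 0 < u i) (hMu : ∀ i, ∑ j, M i j * u j < 0)
    (hz : ∀ i, ∑ j, M i j * z j < 0) : ∀ i, 0 < z i := by
  by_contra! hcon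
  obtain ⟨i₀, hi₀⟩ := hcon
  have : Nonempty ι := ⟨i₀⟩
  obtain ⟨i, hi⟩ := Finite.exists_min (fun i => z i / u i)
  set c := z i / u i with hc
  have hc0 : c ≤ 0 := (hi i₀).trans (div_nonpos_of_nonpos_of_nonneg hi₀ (hu i₀).le)
  have h1 : ∀ j, 0 ≤ z j - c * u j := fun j => by
    have := (le_div_iff₀ (hu j)).1 (hi j)
    linarith
  have h2 : z i - c * u i = 0 := by
    rw [hc]; field_simp [(hu i).ne']; ring
  have h3 : 0 ≤ ∑ j, M i j * (z j - c * u j) := by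
    refine Finset.sum_nonneg fun j _ => ?_
    by_cases h : i = j
    · subst h; rw [h2]; simp
    · exact mul_nonneg (hM i j h) (h1 j)
  have h4 : ∑ j, M i j * (z j - c * u j) = ∑ j, M i j * z j - c * ∑ j, M i j * u j := by
    rw [Finset.mul_sum, ← Finset.sum_sub_distrib]
    exact Finset.sum_congr rfl fun j _ => by ring
  have h5 := mul_nonneg_of_nonpos_of_nonpos hc0 (hMu i).le
  have := hz i
  linarith

lemma metzler_hurwitz_of_exists {ι : Type*} [Fintype ι] [DecidableEq ι] {M : Matrix ι ι ℝ}
    (hM : IsMetzler M) {v : ι → ℝ} (hv : ∀ i, 0 < v i) (hMv : ∀ i, ∑ j, M i j * v j < 0) :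
    IsHurwitz M := by
  intro z hz
  rw [Polynomial.IsRoot, Matrix.eval_charpoly] at hz
  obtain ⟨x, hx0, hx⟩ := Matrix.exists_mulVec_eq_zero_iff.2 hz
  obtain ⟨i₀, hi₀⟩ := Function.ne_iff.1 hx0
  have : Nonempty ι := ⟨i₀⟩
  obtain ⟨i, hi⟩ := Finite.exists_max (fun i => ‖x i‖ / v i)
  set c := ‖x i‖ / v i with hc
  have hcpos : 0 < c := (div_pos (norm_pos_iff.2 hi₀) (hv i₀)).trans_le (hi i₀)
  have hxi : ‖x i‖ = c * v i := by rw [hc]; field_simp [(hv i).ne']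
  have hb : ∀ j, ‖x j‖ ≤ c * v j := fun j => (div_le_iff₀ (hv j)).1 (hi j)
  have heq : z * x i = ∑ j, (M i j : ℂ) * x j := by
    have := congrFun hx i
    rw [Matrix.sub_mulVec] at this
    simp [Matrix.mulVec, dotProduct, Matrix.diagonal_apply] at this
    exact sub_eq_zero.1 this
  rw [← Finset.add_sum_erase _ _ (Finset.mem_univ i)] at heq
  have heq2 : (z - M i i) * x i = ∑ j ∈ Finset.univ.erase i, (M i j : ℂ) * x j := by
    rw [sub_mul, heq]; ring
  have h1 : ‖z - M i i‖ * (c * v i) ≤ ∑ j ∈ Finset.univ.erase i, M i j * (c * v j) := by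
    rw [← hxi, ← norm_mul, heq2]
    refine (norm_sum_le _ _).trans (Finset.sum_le_sum fun j hj => ?_)
    have hm := hM i j (Finset.ne_of_mem_erase hj).symm
    rw [norm_mul, Complex.norm_real, Real.norm_of_nonneg hm]
    exact mul_le_mul_of_nonneg_left (hb j) hm
  have h2 : ∑ j ∈ Finset.univ.erase i, M i j * (c * v j) < - M i i * (c * v i) := by
    have h := hMv i
    rw [← Finset.add_sum_erase _ _ (Finset.mem_univ i)] at h
    have e : ∑ j ∈ Finset.univ.erase i, M i j * (c * v j)
        = c * ∑ j ∈ Finset.univ.erase i, M i j * v j := by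
      rw [Finset.mul_sum]
      exact Finset.sum_congr rfl fun j _ => by ring
    rw [e]
    nlinarith
  have h3 : ‖z - M i i‖ < - M i i := lt_of_mul_lt_mul_right (h1.trans_lt h2)
    (mul_pos hcpos (hv i)).le
  have h4 := Complex.re_le_norm (z - M i i)
  simp at h4
  linarith

lemma metzler_exists_of_hurwitz {ι : Type*} [Fintype ι] [DecidableEq ι] {M : Matrix ι ι ℝ}
    (hM : IsMetzler M) (hH : IsHurwitz M) :
    ∃ v : ι → ℝ, (∀ i, 0 < v i) ∧ ∀ i, ∑ j, M i j * v j < 0 := by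
  let N : ℝ → Matrix ι ι ℝ := fun t => Matrix.scalar ι |t| - M
  have hdet : ∀ t, (N t).det ≠ 0 := by
    intro t h0
    have h1 : M.charpoly.eval |t| = 0 := by rw [Matrix.eval_charpoly]; exact h0
    have h2 : (M.map (Complex.ofReal)).charpoly.IsRoot ((|t| : ℝ) : ℂ) := by
      have := Matrix.charpoly_map M Complex.ofRealHom
      have e : M.map Complex.ofReal = M.map Complex.ofRealHom := rfl
      rw [e, this, Polynomial.IsRoot]
      have := Polynomial.eval_map_apply (p := M.charpoly) (f := Complex.ofRealHom) |t|
      rw [h1] at this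
      simpa using this
    have := hH _ h2
    rw [Complex.ofReal_re] at this
    exact absurd this (not_lt.2 (abs_nonneg t))
  let f : ℝ → ι → ℝ := fun t => (N t).det⁻¹ • ((N t).adjugate *ᵥ (fun _ => 1))
  have hNc : Continuous N := by
    refine Continuous.sub ?_ continuous_const
    simp only [Matrix.scalar_apply]
    exact Continuous.matrix_diagonal (continuous_pi fun _ => continuous_abs)
  have hfc : Continuous f := by
    refine Continuous.smul (hNc.matrix_det.inv₀ hdet) ?_
    exact hNc.matrix_adjugate.matrix_mulVec continuous_const
  have hf : ∀ t i, |t| * f t i - ∑ j, M i j * f t j = 1 := by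
    intro t i
    have h : N t *ᵥ f t = fun _ => 1 := by
      simp only [f]
      rw [Matrix.mulVec_smul, Matrix.mulVec_mulVec, Matrix.mul_adjugate, Matrix.smul_mulVec,
        Matrix.one_mulVec, smul_smul, inv_mul_cancel₀ (hdet t), one_smul]
    have := congrFun h i
    simp only [N] at this
    rw [Matrix.sub_mulVec] at this
    simpa [Matrix.mulVec, dotProduct, Matrix.diagonal_apply] using this
  have hset : {t | ∀ i, 0 < f t i} = {t | ∀ i, 0 ≤ f t i} := by
    ext t
    refine ⟨fun h i => (h i).le, fun h i => lt_of_le_of_ne (h i) fun h0 => ?_⟩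
    have h1 := hf t i
    have h2 : 0 ≤ ∑ j, M i j * f t j := by
      refine Finset.sum_nonneg fun j _ => ?_
      by_cases hij : i = j
      · subst hij; rw [← h0]; simp
      · exact mul_nonneg (hM i j hij) (h j)
    rw [← h0] at h1
    linarith
  have hopen : IsOpen {t | ∀ i, 0 < f t i} := by
    simp only [Set.ofPred_forall]
    exact isOpen_iInter_of_finite fun i =>
      isOpen_lt continuous_const ((continuous_apply i).comp hfc)
  have hclosed : IsClosed {t | ∀ i, 0 < f t i} := by
    rw [hset]
    simp only [Set.ofPred_forall]
    exact isClosed_iInter fun i => isClosed_le continuous_const ((continuous_apply i).comp hfc)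
  have hne : {t | ∀ i, 0 < f t i}.Nonempty := by
    refine ⟨∑ i, |∑ j, M i j| + 1, ?_⟩
    set T := ∑ i, |∑ j, M i j| + 1 with hT
    have hsum0 : 0 ≤ ∑ i, |∑ j, M i j| := Finset.sum_nonneg fun i _ => abs_nonneg _
    have hTabs : |T| = T := abs_of_nonneg (by linarith)
    have hTb : ∀ i, ∑ j, M i j < T := fun i => by
      have h1 : |∑ j, M i j| ≤ ∑ i, |∑ j, M i j| := Finset.single_le_sum (f := fun i => |∑ j, M i j|)
        (fun i _ => abs_nonneg _) (Finset.mem_univ i)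
      have := le_abs_self (∑ j, M i j)
      linarith
    have key : ∀ (w : ι → ℝ) i, ∑ j, (M - Matrix.diagonal (fun _ => T) : Matrix ι ι ℝ) i j * w j
        = ∑ j, M i j * w j - T * w i := by
      intro w i
      simp [sub_mul, Matrix.diagonal_apply]
    refine metzler_pos_of_super (M := M - Matrix.diagonal fun _ => T) (u := fun _ => 1) ?_
      (fun _ => one_pos) ?_ ?_
    · intro i j hij
      simpa [Matrix.diagonal_apply, hij] using hM i j hij
    · intro i
      rw [key]
      simpa using hTb i
    · intro i
      rw [key]
      have := hf T i
      rw [hTabs] at this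
      linarith
  have huniv := IsClopen.eq_univ ⟨hclosed, hopen⟩ hne
  have h0 : (0 : ℝ) ∈ {t | ∀ i, 0 < f t i} := huniv ▸ Set.mem_univ _
  refine ⟨f 0, h0, fun i => ?_⟩
  have := hf 0 i
  simp at this
  linarith

lemma metzler_hurwitz_iff_left {ι : Type*} [Fintype ι] [DecidableEq ι] {M : Matrix ι ι ℝ}
    (hM : IsMetzler M) :
    IsHurwitz M ↔ ∃ v : ι → ℝ, (∀ i, 0 < v i) ∧ ∀ j, ∑ i, v i * M i j < 0 := by
  have hT : IsMetzler Mᵀ := fun i j h => hM j i h.symm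
  have e : IsHurwitz M ↔ IsHurwitz Mᵀ := by
    unfold IsHurwitz
    rw [Matrix.transpose_map, Matrix.charpoly_transpose]
  rw [e]
  constructor
  · intro h
    obtain ⟨v, hv, h⟩ := metzler_exists_of_hurwitz hT h
    exact ⟨v, hv, fun j => by simpa [mul_comm] using h j⟩
  · rintro ⟨v, hv, h⟩
    exact metzler_hurwitz_of_exists hT hv (fun j => by simpa [mul_comm] using h j)

/-- Ergodicity of delayed unimolecular networks: with phase-type delay lines (Metzler,
Hurwitz stable subgenerators `Hᵢ` with `Hᵢ𝟙 ≤ 0`, nonnegative input probability row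
vectors `αᵢ` summing to one, nonnegative input propensity vectors `qᵢ`), a Metzler
matrix `A` and nonnegative output stoichiometry `S`, the characteristic matrix
`𝒜 = [[A, B],[C, Hᵀ]]` of the augmented network (`B = S·W_out`) is Hurwitz stable if
and only if the characteristic matrix `A_df = A + S·W_in` of the delay-free network is
Hurwitz stable. -/
theorem delayed_unimolecular_ergodic_iff_delay_free (n d : ℕ) (hn : 0 < n) (hd : 0 < d)
    (dm : Fin n → ℕ)
    (Hm : ∀ i, Matrix (Fin (dm i)) (Fin (dm i)) ℝ)
    (hHmetzler : ∀ i, IsMetzler (Hm i))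
    (hHhurwitz : ∀ i, IsHurwitz (Hm i))
    (hHrow : ∀ i, ∀ b, ∑ a, Hm i b a ≤ 0)
    (α : ∀ i, Fin (dm i) → ℝ) (hαpos : ∀ i a, 0 ≤ α i a) (hα : ∀ i, ∑ a, α i a = 1)
    (q : Fin n → Fin d → ℝ) (hq : ∀ i k, 0 ≤ q i k)
    (A : Matrix (Fin d) (Fin d) ℝ) (hA : IsMetzler A)
    (S : Matrix (Fin d) (Fin n) ℝ) (hS : ∀ i j, 0 ≤ S i j) :
    IsHurwitz
        (Matrix.fromBlocks A
          (S * (Matrix.of fun (i : Fin n) (p : Σ i, Fin (dm i)) =>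
            if i = p.1 then -(∑ a, Hm p.1 p.2 a) else 0))
          (Matrix.of fun (p : Σ i, Fin (dm i)) (k : Fin d) => α p.1 p.2 * q p.1 k)
          ((Matrix.blockDiagonal' Hm)ᵀ)) ↔
      IsHurwitz (A + S * Matrix.of q) := by
  classical
  have hdfM : IsMetzler (A + S * Matrix.of q) := fun i j h => by
    rw [Matrix.add_apply, Matrix.mul_apply]
    exact add_nonneg (hA i j h) (Finset.sum_nonneg fun k _ => mul_nonneg (hS i k) (hq k j))
  rw [metzler_hurwitz_iff_left hdfM, metzler_hurwitz_iff_left]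
  swap
  · rintro (i | ⟨i, a⟩) (j | ⟨j, b⟩) hne
    · exact hA i j (fun h => hne (by rw [h]))
    · simp only [Matrix.fromBlocks_apply₁₂, Matrix.mul_apply, Matrix.of_apply]
      refine Finset.sum_nonneg fun k _ => mul_nonneg (hS i k) ?_
      split_ifs
      · have := hHrow j b
        linarith
      · exact le_rfl
    · exact mul_nonneg (hαpos i a) (hq i j)
    · simp only [Matrix.fromBlocks_apply₂₂, Matrix.transpose_apply]
      by_cases hij : j = i
      · subst hij
        rw [Matrix.blockDiagonal'_apply_eq]
        exact hHmetzler j b a (fun h => hne (by rw [h]))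
      · rw [Matrix.blockDiagonal'_apply_ne _ _ _ hij]
  -- the two families of inequalities
  have hB : ∀ (x : Fin d → ℝ) (y : (Σ i, Fin (dm i)) → ℝ) (i : Fin n) (b : Fin (dm i)),
      (∑ k, x k * (S * (Matrix.of fun (i : Fin n) (p : Σ i, Fin (dm i)) =>
            if i = p.1 then -(∑ a, Hm p.1 p.2 a) else 0) :
            Matrix (Fin d) (Σ i, Fin (dm i)) ℝ) k ⟨i, b⟩)
        + ∑ p : (Σ i, Fin (dm i)), y p * (Matrix.blockDiagonal' Hm)ᵀ p ⟨i, b⟩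
      = ∑ a, Hm i b a * (y ⟨i, a⟩ - ∑ k, x k * S k i) := by
    intro x y i b
    rw [Fintype.sum_sigma, Finset.sum_eq_single i]
    · simp only [Matrix.mul_apply, Matrix.of_apply, Matrix.transpose_apply,
        Matrix.blockDiagonal'_apply_eq, mul_ite, mul_zero, Finset.sum_ite_eq', Finset.mem_univ,
        if_true, mul_sub, Finset.sum_sub_distrib, ← Finset.sum_mul]
      have e1 : ∑ k, x k * (S k i * -∑ a, Hm i b a)
          = - ((∑ a, Hm i b a) * ∑ k, x k * S k i) := by
        rw [Finset.mul_sum, ← Finset.sum_neg_distrib (f := fun k => (∑ a, Hm i b a) * (x k * S k i))]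
        exact Finset.sum_congr rfl fun k _ => by ring
      have e2 : ∑ a, y ⟨i, a⟩ * Hm i b a = ∑ a, Hm i b a * y ⟨i, a⟩ :=
        Finset.sum_congr rfl fun k _ => mul_comm _ _
      rw [e1, e2]
      ring
    · intro j _ hj
      refine Finset.sum_eq_zero fun a _ => ?_
      rw [Matrix.transpose_apply, Matrix.blockDiagonal'_apply_ne _ _ _ (Ne.symm hj), mul_zero]
    · simp
  have hC : ∀ (y : (Σ i, Fin (dm i)) → ℝ) (k : Fin d),
      ∑ p : (Σ i, Fin (dm i)), y p * (α p.1 p.2 * q p.1 k)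
      = ∑ i, (∑ a, α i a * y ⟨i, a⟩) * q i k := by
    intro y k
    rw [Fintype.sum_sigma]
    refine Finset.sum_congr rfl fun i _ => ?_
    rw [Finset.sum_mul]
    exact Finset.sum_congr rfl fun a _ => by ring
  have hD : ∀ (x : Fin d → ℝ) (k : Fin d), ∑ i, x i * (A + S * Matrix.of q) i k
      = ∑ i, x i * A i k + ∑ i, (∑ l, x l * S l i) * q i k := by
    intro x k
    simp only [Matrix.add_apply, Matrix.mul_apply, Matrix.of_apply, mul_add,
      Finset.sum_add_distrib, Finset.mul_sum, Finset.sum_mul]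
    congr 1
    rw [Finset.sum_comm]
    exact Finset.sum_congr rfl fun i _ => Finset.sum_congr rfl fun a _ => by ring
  choose u hu hHu using fun i => metzler_exists_of_hurwitz (hHmetzler i) (hHhurwitz i)
  constructor
  · rintro ⟨v, hv, h⟩
    refine ⟨fun k => v (Sum.inl k), fun k => hv _, fun k => ?_⟩
    have h1 := h (Sum.inl k)
    simp only [Fintype.sum_sum_type, Matrix.fromBlocks_apply₁₁, Matrix.fromBlocks_apply₂₁,
      Matrix.of_apply] at h1
    rw [hC (fun p => v (Sum.inr p))] at h1
    rw [hD]
    refine lt_of_le_of_lt ?_ h1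
    gcongr with i _
    · exact hq i k
    · have h2 : ∀ b, ∑ a, Hm i b a * (v (Sum.inr ⟨i, a⟩) - ∑ k, v (Sum.inl k) * S k i) < 0 := by
        intro b
        have h3 := h (Sum.inr ⟨i, b⟩)
        simp only [Fintype.sum_sum_type, Matrix.fromBlocks_apply₁₂,
          Matrix.fromBlocks_apply₂₂] at h3
        rwa [hB (fun k => v (Sum.inl k)) (fun p => v (Sum.inr p))] at h3
      have h4 := metzler_pos_of_super (hHmetzler i) (hu i) (hHu i) h2
      calc ∑ l, v (Sum.inl l) * S l i = ∑ a, α i a * ∑ l, v (Sum.inl l) * S l i := by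
            rw [← Finset.sum_mul, hα, one_mul]
        _ ≤ _ := Finset.sum_le_sum fun a _ =>
            mul_le_mul_of_nonneg_left (sub_pos.1 (h4 a)).le (hαpos i a)
  · rintro ⟨x, hx, h⟩
    have hε : ∃ ε : ℝ, 0 < ε ∧ ∀ k, ∑ i, x i * (A + S * Matrix.of q) i k
        + ε * ∑ i, (∑ a, α i a * u i a) * q i k < 0 := by
      have : ∀ k, ∀ᶠ ε in nhdsWithin (0 : ℝ) (Set.Ioi 0), ∑ i, x i * (A + S * Matrix.of q) i k
        + ε * ∑ i, (∑ a, α i a * u i a) * q i k < 0 := by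
        intro k
        have hc : Continuous fun ε : ℝ => ∑ i, x i * (A + S * Matrix.of q) i k
          + ε * ∑ i, (∑ a, α i a * u i a) * q i k := by fun_prop
        have := hc.continuousAt.eventually_lt (x₀ := 0) (continuousAt_const (y := (0 : ℝ)))
          (by simpa using h k)
        exact this.filter_mono nhdsWithin_le_nhds
      obtain ⟨ε, h1, h2⟩ := ((Filter.eventually_all.2 this).and self_mem_nhdsWithin).exists
      exact ⟨ε, h2, h1⟩
    obtain ⟨ε, hε0, hε⟩ := hε
    have hw : ∀ i, 0 ≤ ∑ k, x k * S k i := fun i =>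
      Finset.sum_nonneg fun k _ => mul_nonneg (hx k).le (hS k i)
    refine ⟨Sum.elim x (fun p => ∑ k, x k * S k p.1 + ε * u p.1 p.2), ?_, ?_⟩
    · rintro (k | ⟨i, a⟩)
      · exact hx k
      · exact add_pos_of_nonneg_of_pos (hw i) (mul_pos hε0 (hu i a))
    · rintro (k | ⟨i, b⟩)
      · simp only [Fintype.sum_sum_type, Matrix.fromBlocks_apply₁₁, Matrix.fromBlocks_apply₂₁,
          Matrix.of_apply, Sum.elim_inl, Sum.elim_inr]
        rw [hC (fun p => ∑ k, x k * S k p.1 + ε * u p.1 p.2)]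
        have h1 := hε k
        rw [hD] at h1
        refine lt_of_eq_of_lt ?_ h1
        rw [add_assoc, Finset.mul_sum, ← Finset.sum_add_distrib]
        congr 1
        refine Finset.sum_congr rfl fun i _ => ?_
        simp only [mul_add, Finset.sum_add_distrib]
        rw [← Finset.sum_mul, hα, one_mul, add_mul, ← mul_assoc, Finset.mul_sum]
        congr 2
        exact Finset.sum_congr rfl fun a _ => by ring
      · simp only [Fintype.sum_sum_type, Matrix.fromBlocks_apply₁₂,
          Matrix.fromBlocks_apply₂₂, Sum.elim_inl, Sum.elim_inr]
        rw [hB x (fun p => ∑ k, x k * S k p.1 + ε * u p.1 p.2)]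
        have : ∑ a, Hm i b a * (∑ k, x k * S k i + ε * u i a - ∑ k, x k * S k i)
            = ε * ∑ a, Hm i b a * u i a := by
          rw [Finset.mul_sum]
          exact Finset.sum_congr rfl fun a _ => by ring
        rw [this]
        exact mul_neg_of_pos_of_neg hε0 (hHu i b)
end

section
/- Fix positive reals μ, γ₁, γ₂, k₂ and define, for λ > 0, V_λ = μ · [γ₁γ₂(γ₁+γ₂) + λ(γ₁+γ₂)(γ₁+γ₂+k₂) + λ²(γ₁+γ₂+k₂)] / [(γ₁+γ₂)(γ₁+λ)(γ₂+λ)]. Then the function λ ↦ V_λ is strictly increasing on (0,∞); equivalently, the ratio R(λ) = V_λ / [μ(1 + k₂/(γ₁+γ₂))] has derivative R′(λ) = γ₁γ₂(γ₁k₂ + γ₂k₂ + 2k₂λ) / [(γ₁+γ₂+k₂)(γ₁+λ)²(γ₂+λ)²] > 0 for all λ > 0. -/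
/-- The stationary protein variance
`V_λ = μ [γ₁γ₂(γ₁+γ₂) + λ(γ₁+γ₂)(γ₁+γ₂+k₂) + λ²(γ₁+γ₂+k₂)] / [(γ₁+γ₂)(γ₁+λ)(γ₂+λ)]`
of the delayed gene expression network is strictly increasing in the delay rate `λ` on
`(0,∞)`; equivalently, the ratio `R(λ) = V_λ / [μ(1+k₂/(γ₁+γ₂))]` satisfies
`R′(λ) = γ₁γ₂(γ₁k₂+γ₂k₂+2k₂λ) / [(γ₁+γ₂+k₂)(γ₁+λ)²(γ₂+λ)²] > 0` for all `λ > 0`. -/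
theorem delayed_variance_strictMono (μ γ₁ γ₂ k₂ : ℝ)
    (hμ : 0 < μ) (hγ₁ : 0 < γ₁) (hγ₂ : 0 < γ₂) (hk₂ : 0 < k₂) :
    StrictMonoOn
        (fun l : ℝ =>
          μ * (γ₁ * γ₂ * (γ₁ + γ₂) + l * (γ₁ + γ₂) * (γ₁ + γ₂ + k₂) +
            l ^ 2 * (γ₁ + γ₂ + k₂)) / ((γ₁ + γ₂) * (γ₁ + l) * (γ₂ + l)))
        (Set.Ioi 0) ∧
      ∀ l : ℝ, 0 < l →
        HasDerivAt
          (fun l : ℝ =>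
            (μ * (γ₁ * γ₂ * (γ₁ + γ₂) + l * (γ₁ + γ₂) * (γ₁ + γ₂ + k₂) +
              l ^ 2 * (γ₁ + γ₂ + k₂)) / ((γ₁ + γ₂) * (γ₁ + l) * (γ₂ + l))) /
              (μ * (1 + k₂ / (γ₁ + γ₂))))
          (γ₁ * γ₂ * (γ₁ * k₂ + γ₂ * k₂ + 2 * k₂ * l) /
            ((γ₁ + γ₂ + k₂) * (γ₁ + l) ^ 2 * (γ₂ + l) ^ 2)) l ∧
        0 < γ₁ * γ₂ * (γ₁ * k₂ + γ₂ * k₂ + 2 * k₂ * l) /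
            ((γ₁ + γ₂ + k₂) * (γ₁ + l) ^ 2 * (γ₂ + l) ^ 2) := by
  have hs : 0 < γ₁ + γ₂ := by positivity
  have hsk : 0 < γ₁ + γ₂ + k₂ := by positivity
  refine ⟨?_, ?_⟩
  · intro a ha b hb hab
    have ha' : 0 < a := ha
    have hb' : 0 < b := hb
    have hba : 0 < b - a := sub_pos.mpr hab
    rw [← sub_pos]
    have key : μ * (γ₁ * γ₂ * (γ₁ + γ₂) + b * (γ₁ + γ₂) * (γ₁ + γ₂ + k₂) +
            b ^ 2 * (γ₁ + γ₂ + k₂)) / ((γ₁ + γ₂) * (γ₁ + b) * (γ₂ + b)) -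
          μ * (γ₁ * γ₂ * (γ₁ + γ₂) + a * (γ₁ + γ₂) * (γ₁ + γ₂ + k₂) +
            a ^ 2 * (γ₁ + γ₂ + k₂)) / ((γ₁ + γ₂) * (γ₁ + a) * (γ₂ + a)) =
        μ * k₂ * γ₁ * γ₂ * (b - a) * (γ₁ + γ₂ + a + b) /
          ((γ₁ + γ₂) * (γ₁ + a) * (γ₂ + a) * (γ₁ + b) * (γ₂ + b)) := by
      have h1 : γ₁ + a ≠ 0 := by positivity
      have h2 : γ₂ + a ≠ 0 := by positivity
      have h3 : γ₁ + b ≠ 0 := by positivity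
      have h4 : γ₂ + b ≠ 0 := by positivity
      field_simp
      ring
    show 0 < _ - _
    rw [key]
    positivity
  · intro l hl
    refine ⟨?_, by positivity⟩
    have h1 : γ₁ + l ≠ 0 := by positivity
    have h2 : γ₂ + l ≠ 0 := by positivity
    have hd : (γ₁ + γ₂) * (γ₁ + l) * (γ₂ + l) ≠ 0 := by positivity
    have hx := hasDerivAt_id' l
    have hN := ((((hx.mul_const (γ₁ + γ₂)).mul_const (γ₁ + γ₂ + k₂)).const_add
      (γ₁ * γ₂ * (γ₁ + γ₂))).add ((hx.pow 2).mul_const (γ₁ + γ₂ + k₂))).const_mul μ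
    have hD := ((hx.const_add γ₁).const_mul (γ₁ + γ₂)).mul (hx.const_add γ₂)
    have h := (hN.div hD hd).div_const (μ * (1 + k₂ / (γ₁ + γ₂)))
    refine h.congr_deriv ?_
    have hne : 1 + k₂ / (γ₁ + γ₂) = (γ₁ + γ₂ + k₂) / (γ₁ + γ₂) := by field_simp
    rw [hne]
    simp only [Pi.add_apply, Pi.mul_apply, Pi.pow_apply]
    field_simp
    push_cast
    ring
end

section
/- Fix positive reals μ, γ₁, γ₂, k₂ and define, for λ > 0, V_λ = μ · [γ₁γ₂(γ₁+γ₂) + λ(γ₁+γ₂)(γ₁+γ₂+k₂) + λ²(γ₁+γ₂+k₂)] / [(γ₁+γ₂)(γ₁+λ)(γ₂+λ)], and V = μ(1 + k₂/(γ₁+γ₂)). Then μ < V_λ < V for all λ ∈ (0,∞), and V_λ → V as λ → ∞. -/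
open Filter Topology

/-- The stationary protein variance `V_λ` of the delayed gene expression network
satisfies `μ < V_λ < V = μ(1 + k₂/(γ₁+γ₂))` for all delay rates `λ ∈ (0,∞)`, and
`V_λ → V` as `λ → ∞`: the exponential delay reduces the protein noise below its
delay-free value `V` but never below the Poisson level `μ`. -/
theorem delayed_variance_bounds (μ γ₁ γ₂ k₂ : ℝ)
    (hμ : 0 < μ) (hγ₁ : 0 < γ₁) (hγ₂ : 0 < γ₂) (hk₂ : 0 < k₂) :
    (∀ l : ℝ, 0 < l →
      μ < μ * (γ₁ * γ₂ * (γ₁ + γ₂) + l * (γ₁ + γ₂) * (γ₁ + γ₂ + k₂) +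
          l ^ 2 * (γ₁ + γ₂ + k₂)) / ((γ₁ + γ₂) * (γ₁ + l) * (γ₂ + l)) ∧
        μ * (γ₁ * γ₂ * (γ₁ + γ₂) + l * (γ₁ + γ₂) * (γ₁ + γ₂ + k₂) +
          l ^ 2 * (γ₁ + γ₂ + k₂)) / ((γ₁ + γ₂) * (γ₁ + l) * (γ₂ + l)) <
          μ * (1 + k₂ / (γ₁ + γ₂))) ∧
      Tendsto
        (fun l : ℝ =>
          μ * (γ₁ * γ₂ * (γ₁ + γ₂) + l * (γ₁ + γ₂) * (γ₁ + γ₂ + k₂) +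
            l ^ 2 * (γ₁ + γ₂ + k₂)) / ((γ₁ + γ₂) * (γ₁ + l) * (γ₂ + l)))
        atTop (𝓝 (μ * (1 + k₂ / (γ₁ + γ₂)))) := by
  have hs : 0 < γ₁ + γ₂ := by positivity
  have key : ∀ l : ℝ, 0 < l →
      μ * (γ₁ * γ₂ * (γ₁ + γ₂) + l * (γ₁ + γ₂) * (γ₁ + γ₂ + k₂) +
          l ^ 2 * (γ₁ + γ₂ + k₂)) / ((γ₁ + γ₂) * (γ₁ + l) * (γ₂ + l)) =
        μ * (1 + k₂ / (γ₁ + γ₂)) -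
          μ * k₂ * γ₁ * γ₂ / (γ₁ + γ₂) * ((γ₁ + l)⁻¹ * (γ₂ + l)⁻¹) := by
    intro l hl
    have h1 : γ₁ + l ≠ 0 := by positivity
    have h2 : γ₂ + l ≠ 0 := by positivity
    have h3 : γ₁ + γ₂ ≠ 0 := hs.ne'
    field_simp
    ring
  refine ⟨fun l hl => ⟨?_, ?_⟩, ?_⟩
  · have hD : 0 < (γ₁ + γ₂) * (γ₁ + l) * (γ₂ + l) := by positivity
    rw [lt_div_iff₀ hD]
    have : 0 < μ * (k₂ * (l * (γ₁ + γ₂) + l ^ 2)) := by positivity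
    linarith
  · rw [key l hl]
    have : 0 < μ * k₂ * γ₁ * γ₂ / (γ₁ + γ₂) * ((γ₁ + l)⁻¹ * (γ₂ + l)⁻¹) := by positivity
    linarith
  · have t1 : Tendsto (fun l : ℝ => (γ₁ + l)⁻¹) atTop (𝓝 0) :=
      tendsto_inv_atTop_zero.comp (tendsto_atTop_add_const_left _ _ tendsto_id)
    have t2 : Tendsto (fun l : ℝ => (γ₂ + l)⁻¹) atTop (𝓝 0) :=
      tendsto_inv_atTop_zero.comp (tendsto_atTop_add_const_left _ _ tendsto_id)
    have t := ((t1.mul t2).const_mul (μ * k₂ * γ₁ * γ₂ / (γ₁ + γ₂))).const_sub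
      (μ * (1 + k₂ / (γ₁ + γ₂)))
    simp only [mul_zero, sub_zero] at t
    refine t.congr' ?_
    filter_upwards [eventually_gt_atTop 0] with l hl
    exact (key l hl).symm
end

section
/- Let M be a d×d Metzler matrix and let 1 ≤ ℓ ≤ d. Then the following two statements are equivalent: (a) there exist vectors v ∈ ℝ^d with all entries positive such that vᵀM has all entries negative, and w ∈ ℝ^d with all entries nonnegative, with w₁ > 0 and w_ℓ > 0, such that wᵀM + e_ℓᵀ = 0; (b) M is Hurwitz stable and the linear system (M, e₁, e_ℓᵀ) is output controllable, i.e., the 1×d row vector (e_ℓᵀe₁, e_ℓᵀM e₁, …, e_ℓᵀM^{d−1} e₁) has rank 1 (equivalently, is nonzero). -/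
open Matrix

/-- value of a row-vector product at an index where the vector vanishes -/
lemma metz_zero_nonneg {d : ℕ} {M : Matrix (Fin d) (Fin d) ℝ} (hM : IsMetzler M)
    (u : Fin d → ℝ) (hu : ∀ i, 0 ≤ u i) (j : Fin d) (hj : u j = 0) : 0 ≤ (u ᵥ* M) j := by
  simp only [Matrix.vecMul, dotProduct]
  refine Finset.sum_nonneg fun i _ => ?_
  by_cases h : i = j
  · subst h; simp [hj]
  · exact mul_nonneg (hu i) (hM i j h)

lemma metz_mono {d : ℕ} {M : Matrix (Fin d) (Fin d) ℝ} (hM : IsMetzler M)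
    (v : Fin d → ℝ) (hv : ∀ i, 0 < v i) (hvM : ∀ j, (v ᵥ* M) j < 0)
    (u : Fin d → ℝ) (hu : ∀ j, (u ᵥ* M) j ≤ 0) : ∀ i, 0 ≤ u i := by
  by_contra! hcon
  obtain ⟨k, hk⟩ := hcon
  obtain ⟨i, -, hi⟩ := Finset.exists_min_image Finset.univ (fun i => u i / v i) ⟨k, Finset.mem_univ k⟩
  have ht : u i / v i < 0 := lt_of_le_of_lt (hi k (Finset.mem_univ k)) (div_neg_of_neg_of_pos hk (hv k))
  set t := u i / v i with htdef
  have h1 := metz_zero_nonneg hM (u - t • v) (fun j => by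
    have := hi j (Finset.mem_univ j)
    rw [le_div_iff₀ (hv j)] at this
    simpa using this) i (by
    have := (hv i).ne'
    simp [htdef, this])
  rw [Matrix.sub_vecMul, Matrix.smul_vecMul] at h1
  simp only [Pi.sub_apply, Pi.smul_apply, smul_eq_mul] at h1
  nlinarith [hu i, hvM i, mul_pos_of_neg_of_neg ht (hvM i)]

lemma metz_hurwitz {d : ℕ} {M : Matrix (Fin d) (Fin d) ℝ} (hM : IsMetzler M)
    (v : Fin d → ℝ) (hv : ∀ i, 0 < v i) (hvM : ∀ j, (v ᵥ* M) j < 0) : IsHurwitz M := by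
  intro z hz
  by_contra! hre
  rw [Polynomial.IsRoot, Matrix.eval_charpoly, ← Matrix.exists_mulVec_eq_zero_iff] at hz
  obtain ⟨x, hx0, hx⟩ := hz
  have key : ∀ i, 0 ≤ (M *ᵥ (fun j => ‖x j‖)) i := by
    intro i
    have h := congrFun hx i
    rw [Matrix.sub_mulVec] at h
    simp only [Matrix.scalar_apply, Matrix.mulVec_diagonal, Pi.sub_apply, Pi.zero_apply,
      Matrix.mulVec, dotProduct, Matrix.map_apply] at h
    simp only [Matrix.diagonal_apply, ite_mul, zero_mul, Finset.sum_ite_eq, Finset.mem_univ, if_true] at h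
    rw [← Finset.add_sum_erase _ _ (Finset.mem_univ i)] at h
    simp only [Matrix.mulVec, dotProduct]
    rw [← Finset.add_sum_erase _ _ (Finset.mem_univ i)]
    have h2 : (z - (M i i : ℂ)) * x i = ∑ j ∈ Finset.univ.erase i, (M i j : ℂ) * x j := by
      linear_combination h
    have h3 : ‖(z - (M i i : ℂ)) * x i‖ ≤ ∑ j ∈ Finset.univ.erase i, M i j * ‖x j‖ := by
      rw [h2]
      refine (norm_sum_le _ _).trans (Finset.sum_le_sum fun j hj => ?_)
      rw [norm_mul, Complex.norm_real, Real.norm_of_nonneg]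
      exact hM i j (Finset.ne_of_mem_erase hj).symm
    have h4 : z.re - M i i ≤ ‖z - (M i i : ℂ)‖ := by
      simpa using Complex.re_le_norm (z - (M i i : ℂ))
    rw [norm_mul] at h3
    nlinarith [norm_nonneg (x i), mul_le_mul_of_nonneg_right h4 (norm_nonneg (x i)),
      mul_nonneg hre (norm_nonneg (x i))]
  have h5 : 0 ≤ v ⬝ᵥ (M *ᵥ (fun j => ‖x j‖)) :=
    Finset.sum_nonneg fun i _ => mul_nonneg (hv i).le (key i)
  rw [Matrix.dotProduct_mulVec] at h5
  obtain ⟨k, hk⟩ := Function.ne_iff.mp hx0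
  have h6 : (v ᵥ* M) ⬝ᵥ (fun j => ‖x j‖) < 0 := by
    refine Finset.sum_neg' (fun j _ => mul_nonpos_of_nonpos_of_nonneg (hvM j).le (norm_nonneg _))
      ⟨k, Finset.mem_univ k, mul_neg_of_neg_of_pos (hvM k) (norm_pos_iff.mpr hk)⟩
  linarith

lemma hurwitz_det_s17 {d : ℕ} {M : Matrix (Fin d) (Fin d) ℝ} (h : IsHurwitz M) (s : ℝ) (hs : 0 ≤ s) :
    M.charpoly.eval s ≠ 0 := by
  intro h0
  have := h (s : ℂ) (by
    have h1 : M.map Complex.ofReal = M.map Complex.ofRealHom := rfl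
    rw [h1, Matrix.charpoly_map, Polynomial.IsRoot]
    have h2 : (s : ℂ) = Complex.ofRealHom s := rfl
    rw [h2, Polynomial.eval_map_apply, h0, map_zero])
  simp at this
  linarith

lemma hurwitz_exists_v {d : ℕ} {M : Matrix (Fin d) (Fin d) ℝ} (hM : IsMetzler M)
    (h : IsHurwitz M) : ∃ v : Fin d → ℝ, (∀ i, 0 < v i) ∧ ∀ j, (v ᵥ* M) j < 0 := by
  let A : Set.Ici (0 : ℝ) → Matrix (Fin d) (Fin d) ℝ := fun s => Matrix.scalar (Fin d) (s : ℝ) - M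
  have hdet : ∀ s, (A s).det ≠ 0 := fun s => by
    have := hurwitz_det_s17 h s s.2
    rwa [Matrix.eval_charpoly] at this
  have hA : Continuous A := by
    refine Continuous.sub ?_ continuous_const
    simp only [Matrix.scalar_apply]
    exact Continuous.matrix_diagonal (continuous_pi fun _ => continuous_subtype_val)
  let U : Set.Ici (0 : ℝ) → Fin d → ℝ := fun s => (A s).det⁻¹ • ((fun _ => 1) ᵥ* (A s).adjugate)
  have hU : Continuous U := by
    refine Continuous.smul (hA.matrix_det.inv₀ hdet) ?_
    exact Continuous.matrix_vecMul continuous_const hA.matrix_adjugate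
  have hUA : ∀ s, U s ᵥ* A s = fun _ => 1 := fun s => by
    simp only [U]
    rw [Matrix.smul_vecMul, Matrix.vecMul_vecMul, Matrix.adjugate_mul, Matrix.vecMul_smul,
      Matrix.vecMul_one, smul_smul, inv_mul_cancel₀ (hdet s), one_smul]
  have hneg : ∀ s j, (U s ᵥ* (-A s)) j = -1 := fun s j => by
    rw [Matrix.vecMul_neg, hUA]; rfl
  have hZ : ∀ s, IsMetzler (-A s) := fun s i j hij => by
    simp [A, Matrix.diagonal_apply_ne _ hij, hM i j hij]
  have heq : {s | ∀ i, 0 ≤ U s i} = {s | ∀ i, 0 < U s i} := by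
    ext s
    refine ⟨fun hs i => lt_of_le_of_ne (hs i) fun h0 => ?_, fun hs i => (hs i).le⟩
    have := metz_zero_nonneg (hZ s) (U s) hs i h0.symm
    rw [hneg] at this
    linarith
  have hclopen : IsClopen {s | ∀ i, 0 ≤ U s i} := by
    constructor
    · simp only [Set.ofPred_forall]
      exact isClosed_iInter fun i => isClosed_le continuous_const ((continuous_apply i).comp hU)
    · rw [heq]
      simp only [Set.ofPred_forall]
      exact isOpen_iInter_of_finite fun i => isOpen_lt continuous_const ((continuous_apply i).comp hU)
  haveI : PreconnectedSpace (Set.Ici (0 : ℝ)) := Subtype.preconnectedSpace isPreconnected_Ici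
  have hne : {s | ∀ i, 0 ≤ U s i}.Nonempty := by
    let S : ℝ := 1 + ∑ j, |((fun _ => 1) ᵥ* M) j|
    have hS : 0 ≤ S := add_nonneg zero_le_one (Finset.sum_nonneg fun _ _ => abs_nonneg _)
    refine ⟨⟨S, hS⟩, ?_⟩
    refine metz_mono (hZ ⟨S, hS⟩) (fun _ => 1) (fun _ => one_pos) (fun j => ?_) _
      (fun j => by rw [hneg]; norm_num)
    have h1 : |((fun _ => 1) ᵥ* M) j| ≤ ∑ j, |((fun _ => (1:ℝ)) ᵥ* M) j| :=
      Finset.single_le_sum (f := fun j => |((fun _ => (1:ℝ)) ᵥ* M) j|)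
        (fun _ _ => abs_nonneg _) (Finset.mem_univ j)
    have h2 := le_abs_self (((fun _ => (1:ℝ)) ᵥ* M) j)
    simp only [A]
    rw [Matrix.vecMul_neg, Matrix.vecMul_sub, Matrix.scalar_apply]
    simp only [Pi.neg_apply, Pi.sub_apply, Matrix.vecMul_diagonal]
    simp only [S]
    linarith
  have huniv := hclopen.eq_univ hne
  rw [heq] at huniv
  have h0 : (⟨0, Set.self_mem_Ici⟩ : Set.Ici (0 : ℝ)) ∈ {s | ∀ i, 0 < U s i} := by rw [huniv]; trivial
  refine ⟨U ⟨0, Set.self_mem_Ici⟩, h0, fun j => ?_⟩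
  have h1 := hneg ⟨0, Set.self_mem_Ici⟩ j
  have h2 : -A ⟨0, Set.self_mem_Ici⟩ = M := by simp [A]
  rw [h2] at h1
  rw [h1]; norm_num

/-- Characterization of antithetic integral controllability for a Metzler matrix `M`
(the characteristic matrix of a unimolecular network with actuated species `1` and
measured species `ℓ`): there exist a positive vector `v` with `vᵀM` entrywise negative
and a nonnegative vector `w` with `w₁ > 0`, `w_ℓ > 0` and `wᵀM + e_ℓᵀ = 0` if and only
if `M` is Hurwitz stable and the system `(M, e₁, e_ℓᵀ)` is output controllable, i.e.
the row vector `(e_ℓᵀe₁, e_ℓᵀMe₁, …, e_ℓᵀM^{d-1}e₁)` is nonzero. -/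
theorem antithetic_conditions_iff_stability_and_output_controllability
    (d : ℕ) (hd : 0 < d) (M : Matrix (Fin d) (Fin d) ℝ) (hM : IsMetzler M)
    (l : Fin d) :
    ((∃ v : Fin d → ℝ, (∀ i, 0 < v i) ∧ ∀ j, (v ᵥ* M) j < 0) ∧
      ∃ w : Fin d → ℝ, (∀ i, 0 ≤ w i) ∧ 0 < w ⟨0, hd⟩ ∧ 0 < w l ∧
        w ᵥ* M + Pi.single l 1 = 0) ↔
    (IsHurwitz M ∧
      ∃ k : Fin d,
        Pi.single l (1 : ℝ) ⬝ᵥ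
          ((M ^ (k : ℕ)) *ᵥ Pi.single (⟨0, hd⟩ : Fin d) (1 : ℝ)) ≠ 0) := by
  have hent : ∀ k : ℕ, Pi.single l (1 : ℝ) ⬝ᵥ
      ((M ^ k) *ᵥ Pi.single (⟨0, hd⟩ : Fin d) (1 : ℝ)) = (M ^ k) l ⟨0, hd⟩ := fun k => by
    simp
  simp only [hent]
  constructor
  · rintro ⟨⟨v, hv, hvM⟩, w, hw, hw0, hwl, hwM⟩
    have hH := metz_hurwitz hM v hv hvM
    refine ⟨hH, ?_⟩
    by_contra! hcon
    have hwM' : w ᵥ* M = - Pi.single l 1 := eq_neg_of_add_eq_zero_left hwM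
    have hc0 := hurwitz_det_s17 hH 0 le_rfl
    rw [← Polynomial.coeff_zero_eq_eval_zero] at hc0
    have hCH := Matrix.aeval_self_charpoly M
    rw [Polynomial.aeval_eq_sum_range, Matrix.charpoly_natDegree_eq_dim, Fintype.card_fin,
      Finset.sum_range_succ'] at hCH
    have h1 := congrArg (fun B => (w ᵥ* B) ⟨0, hd⟩) hCH
    simp only [Matrix.vecMul_add, Matrix.vecMul_sum, Pi.add_apply, Finset.sum_apply,
      Matrix.vecMul_smul, Pi.smul_apply, pow_zero, Matrix.vecMul_one, Matrix.vecMul_zero,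
      Pi.zero_apply, smul_eq_mul] at h1
    rw [Finset.sum_eq_zero, zero_add] at h1
    · exact (mul_ne_zero hc0 hw0.ne') h1
    · intro k hk
      rw [pow_succ', ← Matrix.vecMul_vecMul, hwM', Matrix.neg_vecMul]
      have := hcon ⟨k, Finset.mem_range.mp hk⟩
      simp at this
      simp [this]
  · rintro ⟨hH, k, hk⟩
    obtain ⟨v, hv, hvM⟩ := hurwitz_exists_v hM hH
    refine ⟨⟨v, hv, hvM⟩, ?_⟩
    have hdet : M.det ≠ 0 := by
      have := hurwitz_det_s17 hH 0 le_rfl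
      rw [Matrix.eval_charpoly] at this
      intro h0
      apply this
      simp [Matrix.det_neg, h0]
    let w : Fin d → ℝ := -(Pi.single l 1 ᵥ* M⁻¹)
    have hwM : w ᵥ* M = -Pi.single l 1 := by
      simp only [w]
      rw [Matrix.neg_vecMul, Matrix.vecMul_vecMul, Matrix.nonsing_inv_mul _ (isUnit_iff_ne_zero.mpr hdet),
        Matrix.vecMul_one]
    have hw : ∀ i, 0 ≤ w i := by
      refine metz_mono hM v hv hvM w fun j => ?_
      rw [hwM]
      by_cases h : j = l
      · subst h; simp
      · simp [h]
    have hwl : 0 < w l := by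
      refine lt_of_le_of_ne (hw l) fun h0 => ?_
      have := metz_zero_nonneg hM w hw l h0.symm
      rw [hwM] at this
      simp at this
      linarith
    refine ⟨w, hw, ?_, hwl, by rw [hwM]; simp⟩
    refine lt_of_le_of_ne (hw _) fun h0 => hk ?_
    have hblock : ∀ i j, w i ≠ 0 → w j = 0 → M i j = 0 := by
      intro i j hi hj
      have hjl : j ≠ l := fun h => by rw [h] at hj; exact hwl.ne' hj
      have h1 : (w ᵥ* M) j = 0 := by rw [hwM]; simp [hjl]
      simp only [Matrix.vecMul, dotProduct] at h1
      rw [Finset.sum_eq_zero_iff_of_nonneg] at h1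
      · exact (mul_eq_zero.mp (h1 i (Finset.mem_univ i))).resolve_left hi
      · intro a _
        by_cases h : a = j
        · subst h; simp [hj]
        · exact mul_nonneg (hw a) (hM a j h)
    have hpow : ∀ n : ℕ, ∀ i j, w i ≠ 0 → w j = 0 → (M ^ n) i j = 0 := by
      intro n
      induction n with
      | zero =>
        intro i j hi hj
        have : i ≠ j := fun h => hi (h ▸ hj)
        simp [this]
      | succ n ih =>
        intro i j hi hj
        rw [pow_succ, Matrix.mul_apply]
        refine Finset.sum_eq_zero fun a _ => ?_
        by_cases ha : w a = 0
        · rw [ih i a hi ha, zero_mul]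
        · rw [hblock a j ha hj, mul_zero]
    exact hpow k l _ hwl.ne' h0.symm
end
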